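/- Let 𝕂 be ℝ or ℂ, m, n ≥ 1, ε, η ≥ 0, d := ε+η+1. Let λM_1+M_0 be a pencil of size (η+1)m×(ε+1)n, ΔL_{11}(λ) a pencil of the same size, and let ΔR_ε(λ) ∈ 𝕂[λ]^{(ε+1)n×n} of grade ε and ΔR_η(λ) ∈ 𝕂[λ]^{(η+1)m×m} of grade η satisfy ‖ΔR_ε(λ)‖_F < 1/√2 and ‖ΔR_η(λ)‖_F < 1/√2. Define P(λ) := (Λ_η(λ)ᵀ⊗I_m)(λM_1+M_0)(Λ_ε(λ)⊗I_n) and ΔP(λ) := (Λ_η(λ)ᵀ⊗I_m + ΔR_η(λ)ᵀ)(λM_1+M_0+ΔL_{11}(λ))(Λ_ε(λ)⊗I_n + ΔR_ε(λ)) − P(λ). Then ‖ΔP(λ)‖_F ≤ √d·(5‖ΔL_{11}(λ)‖_F + 4‖λM_1+M_0‖_F·max{‖ΔR_ε(λ)‖_F, ‖ΔR_η(λ)‖_F}). -/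

import Mathlib

open Polynomial Matrix
open scoped Kronecker

/-- Euclidean norm of a (finitely indexed) vector over `𝕂 = ℝ` or `ℂ`. -/
noncomputable def evnorm {𝕂 : Type*} [RCLike 𝕂] {ι : Type*} [Fintype ι] (x : ι → 𝕂) : ℝ :=
  Real.sqrt (∑ i, ‖x i‖ ^ 2)

/-- Frobenius norm of a constant matrix over `𝕂 = ℝ` or `ℂ`. -/
noncomputable def frobNorm {𝕂 : Type*} [RCLike 𝕂] {ι κ : Type*} [Fintype ι] [Fintype κ]
    (A : Matrix ι κ 𝕂) : ℝ :=
  Real.sqrt (∑ i, ∑ j, ‖A i j‖ ^ 2)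

/-- Spectral norm (largest singular value; `ℓ²→ℓ²` operator norm) of a constant matrix:
the least `c ≥ 0` with `‖Ax‖₂ ≤ c‖x‖₂` for all `x`. -/
noncomputable def specNorm {𝕂 : Type*} [RCLike 𝕂] {ι κ : Type*} [Fintype ι] [Fintype κ]
    (A : Matrix ι κ 𝕂) : ℝ :=
  sInf {c : ℝ | 0 ≤ c ∧ ∀ x : κ → 𝕂, evnorm (A.mulVec x) ≤ c * evnorm x}

/-- Frobenius norm of a matrix polynomial `P(λ) = Σ_i P_i λ^i`:
`‖P‖_F = sqrt(Σ_i ‖P_i‖_F²)` (sum over all nonzero coefficients; independent of the grade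
used to represent `P`). -/
noncomputable def polyFrob {𝕂 : Type*} [RCLike 𝕂] {ι κ : Type*} [Fintype ι] [Fintype κ]
    (P : Matrix ι κ (Polynomial 𝕂)) : ℝ :=
  Real.sqrt (∑ i, ∑ j, ∑ k ∈ (P i j).support, ‖(P i j).coeff k‖ ^ 2)

/-- The `(k+1)×1` vector polynomial `Λ_k(λ) = (λ^k, λ^{k-1}, …, λ, 1)ᵀ`. -/
noncomputable def Lam (R : Type*) [CommRing R] (k : ℕ) :
    Matrix (Fin (k + 1)) (Fin 1) (Polynomial R) :=
  Matrix.of fun i _ => Polynomial.X ^ (k - (i : ℕ))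

/-- `Q(λ) := (Λ_η(λ)ᵀ⊗I_m)·(λM₁+M₀)·(Λ_ε(λ)⊗I_n)`, the `m×n` matrix polynomial associated
with the `(1,1)` block `M` of a block Kronecker pencil. -/
noncomputable def QpolyOf (R : Type*) [CommRing R] (ε n η m : ℕ)
    (M : Matrix (Fin (η + 1) × Fin m) (Fin (ε + 1) × Fin n) (Polynomial R)) :
    Matrix (Fin 1 × Fin m) (Fin 1 × Fin n) (Polynomial R) :=
  ((Lam R η).transpose ⊗ₖ (1 : Matrix (Fin m) (Fin m) (Polynomial R))) * M *
    ((Lam R ε) ⊗ₖ (1 : Matrix (Fin n) (Fin n) (Polynomial R)))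

section helpers

variable {𝕂 : Type*} [RCLike 𝕂]

noncomputable def eMap (N : ℕ) : Polynomial 𝕂 →ₗ[𝕂] EuclideanSpace 𝕂 (Fin N) where
  toFun p := WithLp.toLp 2 (fun k => p.coeff k)
  map_add' p q := by ext k; simp
  map_smul' c p := by ext k; simp

lemma eMap_sq (N : ℕ) (p : Polynomial 𝕂) :
    ‖eMap N p‖ ^ 2 = ∑ k ∈ Finset.range N, ‖p.coeff k‖ ^ 2 := by
  rw [EuclideanSpace.norm_sq_eq, Finset.sum_range]
  rfl

lemma eMap_X_mul (N : ℕ) (p : Polynomial 𝕂) : ‖eMap N (X * p)‖ ≤ ‖eMap N p‖ := by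
  refine le_of_sq_le_sq ?_ (norm_nonneg _)
  rw [eMap_sq, eMap_sq]
  cases N with
  | zero => simp
  | succ N =>
    rw [Finset.sum_range_succ', Finset.sum_range_succ]
    simp only [coeff_X_mul, mul_coeff_zero, coeff_X_zero, zero_mul, norm_zero]
    nlinarith [sq_nonneg ‖p.coeff N‖]

lemma eMap_X_pow_mul (N i : ℕ) (p : Polynomial 𝕂) : ‖eMap N (X ^ i * p)‖ ≤ ‖eMap N p‖ := by
  induction i with
  | zero => simp
  | succ i ih =>
    rw [pow_succ', mul_assoc]
    exact (eMap_X_mul N _).trans ih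

lemma eMap_mul (N D : ℕ) (hD : D < N) (p q : Polynomial 𝕂) (hp : p.natDegree ≤ D) :
    ‖eMap N (p * q)‖ ≤ Real.sqrt (D + 1) * (‖eMap N p‖ * ‖eMap N q‖) := by
  have h1 : p * q = ∑ i ∈ Finset.range (D + 1), p.coeff i • (X ^ i * q) := by
    conv_lhs => rw [p.as_sum_range' (D + 1) (by omega)]
    rw [Finset.sum_mul]
    refine Finset.sum_congr rfl fun i _ => ?_
    rw [← C_mul_X_pow_eq_monomial, mul_assoc, smul_eq_C_mul]
  have h2 : ‖eMap N (p * q)‖ ≤ (∑ i ∈ Finset.range (D + 1), ‖p.coeff i‖) * ‖eMap N q‖ := by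
    rw [h1, map_sum, Finset.sum_mul]
    refine (norm_sum_le _ _).trans (Finset.sum_le_sum fun i _ => ?_)
    rw [map_smul, norm_smul]
    exact mul_le_mul_of_nonneg_left (eMap_X_pow_mul N i q) (norm_nonneg _)
  have h3 : (∑ i ∈ Finset.range (D + 1), ‖p.coeff i‖) ≤ Real.sqrt (D + 1) * ‖eMap N p‖ := by
    refine le_of_sq_le_sq ?_ (by positivity)
    rw [mul_pow, Real.sq_sqrt (by positivity), eMap_sq]
    refine (sq_sum_le_card_mul_sum_sq).trans ?_
    rw [Finset.card_range]
    push_cast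
    refine mul_le_mul_of_nonneg_left ?_ (by positivity)
    exact Finset.sum_le_sum_of_subset_of_nonneg
      (Finset.range_subset_range.2 (by omega)) (fun _ _ _ => by positivity)
  calc _ ≤ _ := h2
    _ ≤ _ := mul_le_mul_of_nonneg_right h3 (norm_nonneg _)
    _ = _ := by ring

variable {ι κ τ : Type*} [Fintype ι] [Fintype κ] [Fintype τ]

noncomputable def fN (N : ℕ) (P : Matrix ι κ (Polynomial 𝕂)) : ℝ :=
  ‖(WithLp.toLp 2 (fun x : ι × κ => eMap N (P x.1 x.2)) :
    PiLp 2 (fun _ : ι × κ => EuclideanSpace 𝕂 (Fin N)))‖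

lemma fN_nonneg (N : ℕ) (P : Matrix ι κ (Polynomial 𝕂)) : 0 ≤ fN N P := norm_nonneg _

lemma fN_sq (N : ℕ) (P : Matrix ι κ (Polynomial 𝕂)) :
    fN N P ^ 2 = ∑ i, ∑ j, ‖eMap N (P i j)‖ ^ 2 := by
  rw [fN, PiLp.norm_sq_eq_of_L2, Fintype.sum_prod_type]

lemma fN_add (N : ℕ) (P Q : Matrix ι κ (Polynomial 𝕂)) : fN N (P + Q) ≤ fN N P + fN N Q := by
  unfold fN
  refine le_trans (le_of_eq ?_) (norm_add_le _ _)
  congr 1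

lemma fN_transpose (N : ℕ) (P : Matrix ι κ (Polynomial 𝕂)) : fN N P.transpose = fN N P := by
  rw [← sq_eq_sq₀ (fN_nonneg _ _) (fN_nonneg _ _), fN_sq, fN_sq, Finset.sum_comm]
  rfl

lemma fN_mul_aux (N : ℕ) (D : ℕ) (P : Matrix ι κ (Polynomial 𝕂)) (Q : Matrix κ τ (Polynomial 𝕂))
    (h : ∀ i j k, ‖eMap N (P i j * Q j k)‖ ≤
      Real.sqrt (D + 1) * (‖eMap N (P i j)‖ * ‖eMap N (Q j k)‖)) :
    fN N (P * Q) ≤ Real.sqrt (D + 1) * (fN N P * fN N Q) := by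
  refine le_of_sq_le_sq ?_ (mul_nonneg (by positivity) (mul_nonneg (fN_nonneg _ _) (fN_nonneg _ _)))
  rw [mul_pow, mul_pow, fN_sq, fN_sq, fN_sq, Real.sq_sqrt (by positivity)]
  rw [Finset.sum_mul, Finset.mul_sum]
  refine Finset.sum_le_sum fun i _ => ?_
  rw [Finset.sum_comm (γ := κ), Finset.mul_sum, Finset.mul_sum]
  refine Finset.sum_le_sum fun k _ => ?_
  have h1 : ‖eMap N ((P * Q) i k)‖ ≤
      Real.sqrt (D + 1) * ∑ j, ‖eMap N (P i j)‖ * ‖eMap N (Q j k)‖ := by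
    rw [Matrix.mul_apply, map_sum, Finset.mul_sum]
    exact (norm_sum_le _ _).trans (Finset.sum_le_sum fun j _ => h i j k)
  calc ‖eMap N ((P * Q) i k)‖ ^ 2 ≤
      (Real.sqrt (D + 1) * ∑ j, ‖eMap N (P i j)‖ * ‖eMap N (Q j k)‖) ^ 2 := by gcongr
    _ = (D + 1) * (∑ j, ‖eMap N (P i j)‖ * ‖eMap N (Q j k)‖) ^ 2 := by
      rw [mul_pow, Real.sq_sqrt (by positivity)]
    _ ≤ _ := by
      refine mul_le_mul_of_nonneg_left ?_ (by positivity)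
      exact Finset.sum_mul_sq_le_sq_mul_sq _ _ _

lemma fN_mul_left (N : ℕ) (D : ℕ) (hD : D < N)
    (P : Matrix ι κ (Polynomial 𝕂)) (Q : Matrix κ τ (Polynomial 𝕂))
    (h : ∀ i j, (P i j).natDegree ≤ D) :
    fN N (P * Q) ≤ Real.sqrt (D + 1) * (fN N P * fN N Q) :=
  fN_mul_aux N D P Q fun i j k => eMap_mul N D hD _ _ (h i j)

lemma fN_mul_right (N : ℕ) (D : ℕ) (hD : D < N)
    (P : Matrix ι κ (Polynomial 𝕂)) (Q : Matrix κ τ (Polynomial 𝕂))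
    (h : ∀ i j, (Q i j).natDegree ≤ D) :
    fN N (P * Q) ≤ Real.sqrt (D + 1) * (fN N P * fN N Q) :=
  fN_mul_aux N D P Q fun i j k => by
    rw [mul_comm, mul_comm ‖eMap N (P i j)‖]
    exact eMap_mul N D hD _ _ (h j k)

lemma polyFrob_eq (P : Matrix ι κ (Polynomial 𝕂)) (N : ℕ) (h : ∀ i j, (P i j).natDegree < N) :
    polyFrob P = fN N P := by
  rw [polyFrob, Real.sqrt_eq_iff_eq_sq (by positivity) (fN_nonneg _ _), fN_sq]
  refine Finset.sum_congr rfl fun i _ => Finset.sum_congr rfl fun j _ => ?_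
  rw [eMap_sq]
  refine Finset.sum_subset ?_ ?_
  · intro k hk
    exact Finset.mem_range.2 ((le_natDegree_of_mem_supp _ hk).trans_lt (h i j))
  · intro k _ hk
    rw [notMem_support_iff.1 hk]; simp

lemma polyFrob_ev (P : Matrix ι κ (Polynomial 𝕂)) :
    ∀ᶠ N in Filter.atTop, polyFrob P = fN N P := by
  have : ∀ᶠ N in Filter.atTop, ∀ i j, (P i j).natDegree < N := by
    rw [Filter.eventually_all]; intro i
    rw [Filter.eventually_all]; intro j
    exact Filter.eventually_gt_atTop _
  exact this.mono fun N h => polyFrob_eq P N h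

/-- counting lemma -/
lemma eMap_count (N C : ℕ) (hN : 1 < N) {S : Type*} [Fintype S] (e : S → ℕ) (p : S → Polynomial 𝕂)
    (hp : ∀ s, (p s).natDegree ≤ 1)
    (hC : ∀ k, (Finset.univ.filter fun x : S × Fin 2 => e x.1 + x.2 = k).card ≤ C) :
    ‖eMap N (∑ s, X ^ (e s) * p s)‖ ^ 2 ≤ C * ∑ s, ‖eMap N (p s)‖ ^ 2 := by
  have hc : ∀ k, (∑ s, X ^ (e s) * p s).coeff k =
      ∑ x ∈ Finset.univ.filter (fun x : S × Fin 2 => e x.1 + x.2 = k), (p x.1).coeff x.2 := by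
    intro k
    rw [finsetSum_coeff, Finset.sum_filter, Fintype.sum_prod_type]
    refine Finset.sum_congr rfl fun s _ => ?_
    rw [coeff_X_pow_mul', Fin.sum_univ_two]
    simp only [Fin.val_zero, Fin.val_one, add_zero]
    by_cases h0 : e s = k
    · subst h0; simp
    by_cases h1 : e s + 1 = k
    · subst h1; simp
    simp only [h0, h1, if_false, add_zero]
    split_ifs with h
    · exact coeff_eq_zero_of_natDegree_lt ((hp s).trans_lt (by omega))
    · rfl
  rw [eMap_sq]
  calc _ ≤ ∑ k ∈ Finset.range N, (C : ℝ) *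
        ∑ x ∈ Finset.univ.filter (fun x : S × Fin 2 => e x.1 + x.2 = k),
          ‖(p x.1).coeff x.2‖ ^ 2 := by
        refine Finset.sum_le_sum fun k _ => ?_
        rw [hc]
        refine (pow_le_pow_left₀ (norm_nonneg _) (norm_sum_le _ _) 2).trans ?_
        refine sq_sum_le_card_mul_sum_sq.trans ?_
        refine mul_le_mul_of_nonneg_right ?_ (by positivity)
        exact_mod_cast hC k
    _ = C * ∑ k ∈ Finset.range N,
        ∑ x : S × Fin 2, (if e x.1 + x.2 = k then ‖(p x.1).coeff x.2‖ ^ 2 else 0) := by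
        rw [Finset.mul_sum]
        simp only [Finset.sum_filter]
    _ ≤ C * ∑ x : S × Fin 2, ‖(p x.1).coeff x.2‖ ^ 2 := by
        refine mul_le_mul_of_nonneg_left ?_ (by positivity)
        rw [Finset.sum_comm]
        refine Finset.sum_le_sum fun x _ => ?_
        rw [Finset.sum_ite_eq]
        split_ifs
        · exact le_rfl
        · positivity
    _ ≤ _ := by
        refine mul_le_mul_of_nonneg_left ?_ (by positivity)
        rw [Fintype.sum_prod_type]
        refine Finset.sum_le_sum fun s _ => ?_
        rw [eMap_sq, Fin.sum_univ_two]
        calc _ = ∑ k ∈ Finset.range 2, ‖(p s).coeff k‖ ^ 2 := by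
              simp [Finset.sum_range_succ]
          _ ≤ _ := Finset.sum_le_sum_of_subset_of_nonneg
            (Finset.range_subset_range.2 (by omega)) (fun _ _ _ => by positivity)

lemma count_one (η k : ℕ) :
    (Finset.univ.filter fun x : Fin (η + 1) × Fin 2 => (η - (x.1 : ℕ)) + (x.2 : ℕ) = k).card ≤ 2 := by
  have := Finset.card_le_card_of_injOn (s := Finset.univ.filter
    fun x : Fin (η + 1) × Fin 2 => (η - (x.1 : ℕ)) + (x.2 : ℕ) = k) (t := (Finset.univ : Finset (Fin 2)))
    (fun x => x.2) (by simp) (by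
      rintro ⟨a, b⟩ h ⟨a', b'⟩ h' hb
      simp at h h' hb
      subst hb
      ext <;> simp
      omega)
  simpa using this

lemma count_two (η ε k : ℕ) :
    (Finset.univ.filter fun x : (Fin (η + 1) × Fin (ε + 1)) × Fin 2 =>
      ((η - (x.1.1 : ℕ)) + (ε - (x.1.2 : ℕ))) + (x.2 : ℕ) = k).card ≤ ε + η + 1 := by
  have := Finset.card_le_card_of_injOn (s := Finset.univ.filter
    fun x : (Fin (η + 1) × Fin (ε + 1)) × Fin 2 =>
      ((η - (x.1.1 : ℕ)) + (ε - (x.1.2 : ℕ))) + (x.2 : ℕ) = k) (t := Finset.range (ε + η + 1))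
    (fun x => (x.1.1 : ℕ) + (ε - (x.1.2 : ℕ))) (by
      rintro ⟨⟨a, b⟩, c⟩ h
      simp
      omega) (by
      rintro ⟨⟨a, b⟩, c⟩ h ⟨⟨a', b'⟩, c'⟩ h' hb
      simp at h h' hb
      have := a.2; have := b.2; have := c.2
      have := a'.2; have := b'.2; have := c'.2
      have h1 : (a : ℕ) = a' := by omega
      have h2 : (b : ℕ) = b' := by omega
      have h3 : (c : ℕ) = c' := by omega
      simp [Fin.ext_iff, h1, h2, h3])
  simpa using this

lemma lamL_apply (η m : ℕ) (M : Matrix (Fin (η + 1) × Fin m) κ (Polynomial 𝕂)) (i) (j) :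
    (((Lam 𝕂 η).transpose ⊗ₖ (1 : Matrix (Fin m) (Fin m) (Polynomial 𝕂))) * M) i j =
      ∑ s : Fin (η + 1), X ^ (η - (s : ℕ)) * M (s, i.2) j := by
  rw [Matrix.mul_apply, Fintype.sum_prod_type]
  refine Finset.sum_congr rfl fun s _ => ?_
  simp [Lam, Matrix.kroneckerMap_apply, Matrix.one_apply]

lemma lamR_apply (ε n : ℕ) (M : Matrix κ (Fin (ε + 1) × Fin n) (Polynomial 𝕂)) (i) (j) :
    (M * ((Lam 𝕂 ε) ⊗ₖ (1 : Matrix (Fin n) (Fin n) (Polynomial 𝕂)))) i j =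
      ∑ s : Fin (ε + 1), X ^ (ε - (s : ℕ)) * M i (s, j.2) := by
  rw [Matrix.mul_apply, Fintype.sum_prod_type]
  refine Finset.sum_congr rfl fun s _ => ?_
  simp [Lam, Matrix.kroneckerMap_apply, Matrix.one_apply, mul_comm]

lemma fN_lamL (N η m : ℕ) (hN : 1 < N) (M : Matrix (Fin (η + 1) × Fin m) κ (Polynomial 𝕂))
    (hM : ∀ i j, (M i j).natDegree ≤ 1) :
    fN N (((Lam 𝕂 η).transpose ⊗ₖ (1 : Matrix (Fin m) (Fin m) (Polynomial 𝕂))) * M) ≤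
      Real.sqrt 2 * fN N M := by
  refine le_of_sq_le_sq ?_ (mul_nonneg (by positivity) (fN_nonneg _ _))
  rw [mul_pow, Real.sq_sqrt (by positivity), fN_sq, fN_sq, Fintype.sum_prod_type,
    Fintype.sum_prod_type, Fin.sum_univ_one, Finset.sum_comm (γ := Fin (η + 1)), Finset.mul_sum]
  refine Finset.sum_le_sum fun r _ => ?_
  rw [Finset.sum_comm, Finset.mul_sum]
  refine Finset.sum_le_sum fun j _ => ?_
  rw [lamL_apply]
  exact_mod_cast eMap_count N 2 hN (fun s : Fin (η + 1) => η - (s : ℕ)) _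
    (fun s => hM _ _) (count_one η)

lemma fN_lamR (N ε n : ℕ) (hN : 1 < N) (M : Matrix κ (Fin (ε + 1) × Fin n) (Polynomial 𝕂))
    (hM : ∀ i j, (M i j).natDegree ≤ 1) :
    fN N (M * ((Lam 𝕂 ε) ⊗ₖ (1 : Matrix (Fin n) (Fin n) (Polynomial 𝕂)))) ≤
      Real.sqrt 2 * fN N M := by
  have := fN_lamL N ε n hN M.transpose (fun i j => hM j i)
  rw [fN_transpose, ← fN_transpose] at this
  refine le_trans (le_of_eq ?_) this
  congr 1
  rw [Matrix.transpose_mul, Matrix.transpose_transpose]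
  congr 1
  ext i j
  simp [Matrix.kroneckerMap_apply, Matrix.one_apply, eq_comm]

lemma fN_lamLR (N η m ε n : ℕ) (hN : 1 < N)
    (M : Matrix (Fin (η + 1) × Fin m) (Fin (ε + 1) × Fin n) (Polynomial 𝕂))
    (hM : ∀ i j, (M i j).natDegree ≤ 1) :
    fN N (((Lam 𝕂 η).transpose ⊗ₖ (1 : Matrix (Fin m) (Fin m) (Polynomial 𝕂))) * M *
      ((Lam 𝕂 ε) ⊗ₖ (1 : Matrix (Fin n) (Fin n) (Polynomial 𝕂)))) ≤
      Real.sqrt ((ε + η + 1 : ℕ) : ℝ) * fN N M := by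
  refine le_of_sq_le_sq ?_ (mul_nonneg (by positivity) (fN_nonneg _ _))
  rw [mul_pow, Real.sq_sqrt (by positivity), fN_sq, fN_sq]
  have key : ∀ (r : Fin m) (c : Fin n),
      ‖eMap N ((((Lam 𝕂 η).transpose ⊗ₖ (1 : Matrix (Fin m) (Fin m) (Polynomial 𝕂))) * M *
      ((Lam 𝕂 ε) ⊗ₖ (1 : Matrix (Fin n) (Fin n) (Polynomial 𝕂)))) (0, r) (0, c))‖ ^ 2 ≤
      ((ε + η + 1 : ℕ) : ℝ) * ∑ s : Fin (η + 1), ∑ t : Fin (ε + 1), ‖eMap N (M (s, r) (t, c))‖ ^ 2 := by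
    intro r c
    have := eMap_count N (ε + η + 1) hN
      (fun s : Fin (η + 1) × Fin (ε + 1) => (η - (s.1 : ℕ)) + (ε - (s.2 : ℕ)))
      (fun s => M (s.1, r) (s.2, c)) (fun s => hM _ _) (count_two η ε)
    rw [Fintype.sum_prod_type (f := fun x : Fin (η + 1) × Fin (ε + 1) =>
      ‖eMap N (M (x.1, r) (x.2, c))‖ ^ 2)] at this
    refine le_trans (le_of_eq ?_) this
    congr 3
    rw [lamR_apply, Fintype.sum_prod_type, Finset.sum_comm]
    refine Finset.sum_congr rfl fun t _ => ?_
    rw [lamL_apply, Finset.mul_sum]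
    refine Finset.sum_congr rfl fun s _ => ?_
    rw [pow_add]; ring
  simp only [Fintype.sum_prod_type, Fin.sum_univ_one]
  calc _ ≤ ∑ r : Fin m, ∑ c : Fin n, ((ε + η + 1 : ℕ) : ℝ) *
        ∑ s : Fin (η + 1), ∑ t : Fin (ε + 1), ‖eMap N (M (s, r) (t, c))‖ ^ 2 :=
        Finset.sum_le_sum fun r _ => Finset.sum_le_sum fun c _ => key r c
    _ = _ := by
        simp only [← Finset.mul_sum]
        congr 1
        conv_rhs => rw [Finset.sum_comm]
        refine Finset.sum_congr rfl fun r _ => ?_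
        conv_lhs => rw [Finset.sum_comm]
        refine Finset.sum_congr rfl fun s _ => ?_
        conv_lhs => rw [Finset.sum_comm]

lemma final_arith (s d l M x a b : ℝ) (hs : 0 ≤ s) (hs2 : s ^ 2 = 2) (hd : 0 ≤ d) (hl : 0 ≤ l)
    (hM : 0 ≤ M) (ha : 0 ≤ a) (hb : 0 ≤ b) (hax : a ≤ x) (hbx : b ≤ x) (hx : x * s ≤ 1) :
    d * l + d * (s * (M + l) * b) + d * (s * (M + l) * a) + d * (s * (M + l) * a * b) ≤
      d * (5 * l + 4 * M * x) := by
  have hs15 : s ≤ 3 / 2 := by nlinarith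
  have hx0 : 0 ≤ x := ha.trans hax
  have hx1 : x ≤ 1 := by nlinarith
  have e1 : s * b ≤ s * x := mul_le_mul_of_nonneg_left hbx hs
  have e2 : s * a ≤ s * x := mul_le_mul_of_nonneg_left hax hs
  have e3 : s * a * b ≤ x := by
    calc s * a * b ≤ (s * x) * x := by gcongr
      _ ≤ 1 * x := by gcongr; linarith
      _ = x := one_mul x
  have e4 : s * b + s * a + s * a * b ≤ 4 * x := by nlinarith
  have e5 : s * b + s * a + s * a * b ≤ 4 := by linarith
  have f1 := mul_le_mul_of_nonneg_left e4 hM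
  have f2 := mul_le_mul_of_nonneg_left e5 hl
  have : l + (s * (M + l) * b) + (s * (M + l) * a) + (s * (M + l) * a * b) ≤ 5 * l + 4 * M * x := by
    nlinarith
  have := mul_le_mul_of_nonneg_left this hd
  linarith

end helpers

/-- **Lemma `lemm:Pdelta1`.** With
`P(λ) = (Λ_ηᵀ⊗I_m)(λM₁+M₀)(Λ_ε⊗I_n)` and
`P+ΔP = (Λ_ηᵀ⊗I_m + ΔR_ηᵀ)(λM₁+M₀+ΔL₁₁)(Λ_ε⊗I_n + ΔR_ε)`, if
`‖ΔR_ε‖_F < 1/√2` and `‖ΔR_η‖_F < 1/√2`, then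
`‖ΔP‖_F ≤ √d(5‖ΔL₁₁‖_F + 4‖λM₁+M₀‖_F·max{‖ΔR_ε‖_F, ‖ΔR_η‖_F})`. -/
theorem statement_16 {𝕂 : Type*} [RCLike 𝕂] (m n ε η d : ℕ)
    (hm : 1 ≤ m) (hn : 1 ≤ n) (hd : d = ε + η + 1)
    (M : Matrix (Fin (η + 1) × Fin m) (Fin (ε + 1) × Fin n) (Polynomial 𝕂))
    (hM : ∀ i j, (M i j).natDegree ≤ 1)
    (ΔL11 : Matrix (Fin (η + 1) × Fin m) (Fin (ε + 1) × Fin n) (Polynomial 𝕂))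
    (hΔL11 : ∀ i j, (ΔL11 i j).natDegree ≤ 1)
    (ΔRε : Matrix (Fin (ε + 1) × Fin n) (Fin 1 × Fin n) (Polynomial 𝕂))
    (hΔRεdeg : ∀ i j, (ΔRε i j).natDegree ≤ ε)
    (ΔRη : Matrix (Fin (η + 1) × Fin m) (Fin 1 × Fin m) (Polynomial 𝕂))
    (hΔRηdeg : ∀ i j, (ΔRη i j).natDegree ≤ η)
    (hΔRε : polyFrob ΔRε < 1 / Real.sqrt 2) (hΔRη : polyFrob ΔRη < 1 / Real.sqrt 2) :
    polyFrob
        (((Lam 𝕂 η).transpose ⊗ₖ (1 : Matrix (Fin m) (Fin m) (Polynomial 𝕂)) + ΔRη.transpose) *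
            (M + ΔL11) *
            ((Lam 𝕂 ε) ⊗ₖ (1 : Matrix (Fin n) (Fin n) (Polynomial 𝕂)) + ΔRε) -
          QpolyOf 𝕂 ε n η m M) ≤
      Real.sqrt (d : ℝ) *
        (5 * polyFrob ΔL11 + 4 * polyFrob M * max (polyFrob ΔRε) (polyFrob ΔRη)) := by
  set A := (Lam 𝕂 η).transpose ⊗ₖ (1 : Matrix (Fin m) (Fin m) (Polynomial 𝕂)) with hA
  set B := (Lam 𝕂 ε) ⊗ₖ (1 : Matrix (Fin n) (Fin n) (Polynomial 𝕂)) with hB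
  have hML : ∀ i j, ((M + ΔL11) i j).natDegree ≤ 1 := fun i j =>
    (natDegree_add_le _ _).trans (max_le (hM i j) (hΔL11 i j))
  have hsplit : (A + ΔRη.transpose) * (M + ΔL11) * (B + ΔRε) - QpolyOf 𝕂 ε n η m M =
      A * ΔL11 * B + A * (M + ΔL11) * ΔRε + ΔRη.transpose * ((M + ΔL11) * B)
        + ΔRη.transpose * (M + ΔL11) * ΔRε := by
    rw [QpolyOf, ← hA, ← hB]
    simp only [Matrix.add_mul, Matrix.mul_add, Matrix.mul_assoc]
    abel
  rw [hsplit]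
  obtain ⟨N, h1, h2, h3, h4, h5, h6⟩ := ((polyFrob_ev (A * ΔL11 * B + A * (M + ΔL11) * ΔRε +
    ΔRη.transpose * ((M + ΔL11) * B) + ΔRη.transpose * (M + ΔL11) * ΔRε)).and
    ((polyFrob_ev ΔL11).and ((polyFrob_ev M).and ((polyFrob_ev ΔRε).and ((polyFrob_ev ΔRη).and
    (Filter.eventually_gt_atTop (d + 1))))))).exists
  rw [h4] at hΔRε
  rw [h5] at hΔRη
  rw [h1, h2, h3, h4, h5]
  have hεd : Real.sqrt ((ε : ℝ) + 1) ≤ Real.sqrt d := by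
    apply Real.sqrt_le_sqrt; rw [hd]; push_cast; linarith [(Nat.cast_nonneg η : (0:ℝ) ≤ η)]
  have hηd : Real.sqrt ((η : ℝ) + 1) ≤ Real.sqrt d := by
    apply Real.sqrt_le_sqrt; rw [hd]; push_cast; linarith [(Nat.cast_nonneg ε : (0:ℝ) ≤ ε)]
  have nL := fN_nonneg N ΔL11
  have nM := fN_nonneg N M
  have na := fN_nonneg N ΔRη
  have nb := fN_nonneg N ΔRε
  have nML := fN_nonneg N (M + ΔL11)
  have tML := fN_add N M ΔL11
  have t1 : fN N (A * ΔL11 * B) ≤ Real.sqrt d * fN N ΔL11 := by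
    rw [hd]; exact fN_lamLR N η m ε n (by omega) ΔL11 hΔL11
  have t2 : fN N (A * (M + ΔL11) * ΔRε) ≤
      Real.sqrt d * (Real.sqrt 2 * (fN N M + fN N ΔL11) * fN N ΔRε) := by
    refine (fN_mul_right N ε (by omega) _ _ hΔRεdeg).trans ?_
    have := fN_lamL N η m (by omega) (M + ΔL11) hML
    have n0 := fN_nonneg N (A * (M + ΔL11))
    gcongr
    exact this.trans (by gcongr)
  have t3 : fN N (ΔRη.transpose * ((M + ΔL11) * B)) ≤
      Real.sqrt d * (Real.sqrt 2 * (fN N M + fN N ΔL11) * fN N ΔRη) := by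
    refine (fN_mul_left N η (by omega) ΔRη.transpose _ (fun i j => hΔRηdeg j i)).trans ?_
    have := fN_lamR N ε n (by omega) (M + ΔL11) hML
    have n0 := fN_nonneg N ((M + ΔL11) * B)
    rw [fN_transpose, mul_comm (fN N ΔRη)]
    gcongr
    exact this.trans (by gcongr)
  have t4 : fN N (ΔRη.transpose * (M + ΔL11) * ΔRε) ≤
      Real.sqrt d * (Real.sqrt 2 * (fN N M + fN N ΔL11) * fN N ΔRη * fN N ΔRε) := by
    refine (fN_mul_right N ε (by omega) _ _ hΔRεdeg).trans ?_
    have := fN_mul_right N 1 (by omega) ΔRη.transpose (M + ΔL11) hML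
    have n0 := fN_nonneg N (ΔRη.transpose * (M + ΔL11))
    rw [fN_transpose, mul_comm (fN N ΔRη), ← mul_assoc] at this
    norm_num at this
    gcongr
    exact this.trans (by gcongr)
  have hx : max (fN N ΔRε) (fN N ΔRη) * Real.sqrt 2 ≤ 1 := by
    have := (max_lt hΔRε hΔRη).le
    rwa [le_div_iff₀ (by positivity)] at this
  have fin := final_arith (Real.sqrt 2) (Real.sqrt d) (fN N ΔL11) (fN N M)
    (max (fN N ΔRε) (fN N ΔRη)) (fN N ΔRη) (fN N ΔRε) (by positivity)
    (Real.sq_sqrt (by norm_num)) (by positivity) nL nM na nb (le_max_right _ _) (le_max_left _ _) hx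
  have s1 := fN_add N (A * ΔL11 * B + A * (M + ΔL11) * ΔRε + ΔRη.transpose * ((M + ΔL11) * B))
    (ΔRη.transpose * (M + ΔL11) * ΔRε)
  have s2 := fN_add N (A * ΔL11 * B + A * (M + ΔL11) * ΔRε) (ΔRη.transpose * ((M + ΔL11) * B))
  have s3 := fN_add N (A * ΔL11 * B) (A * (M + ΔL11) * ΔRε)
  linarith
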